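/- Let R and S be rings and M a Frobenius S-R-bimodule. If X is an injective left R-module, then M ⊗_R X is an injective left S-module; if X is a projective left R-module, then M ⊗_R X is a projective left S-module; and if X is a flat left R-module, then M ⊗_R X is a flat left S-module. In particular, the functor M ⊗_R − sends flat-injective left R-modules to flat-injective left S-modules. -/

import Mathlib

/-!
Statement 3: Let `M` be a Frobenius `S`-`R`-bimodule.  If `X` is an injective
(resp. projective, resp. flat) left `R`-module, then `M ⊗_R X` is an injective
(resp. projective, resp. flat) left `S`-module.  In particular `M ⊗_R -` sends
flat-injective modules to flat-injective modules.
-/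

universe u
open MulOpposite
/-- The subgroup of "balanced relations" in `M ⊗[ℤ] X`, for `M` a right `R`-module and
`X` a left `R`-module.  The quotient of `M ⊗[ℤ] X` by this subgroup is the tensor product
`M ⊗_R X` over the (possibly noncommutative) ring `R`. -/
def balRel (R : Type u) [Ring R] (M : Type u) [AddCommGroup M] [Module Rᵐᵒᵖ M]
    (X : Type u) [AddCommGroup X] [Module R X] : Submodule ℤ (TensorProduct ℤ M X) :=
  Submodule.span ℤ
    {z | ∃ (m : M) (r : R) (x : X), z = m ⊗ₜ[ℤ] (r • x) - ((op r) • m) ⊗ₜ[ℤ] x}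

/-- Scalar multiplication `I ⊗[ℤ] F → F`, `i ⊗ v ↦ i • v`, for a right ideal `I` of `R`. -/
noncomputable def idealSmul (R : Type u) [Ring R] (F : Type u) [AddCommGroup F] [Module R F]
    (I : Submodule Rᵐᵒᵖ R) : TensorProduct ℤ (↥I) F →ₗ[ℤ] F :=
  TensorProduct.lift (AddMonoidHom.toIntLinearMap
    { toFun := fun i => AddMonoidHom.toIntLinearMap
        { toFun := fun v => (i : R) • v
          map_zero' := smul_zero _
          map_add' := fun v w => smul_add _ _ _ }
      map_zero' := by ext v; simp
      map_add' := fun i j => by ext v; simp [add_smul] })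

/-- A left module `F` over a (possibly noncommutative) ring `R` is flat if for every
finitely generated right ideal `I` of `R` the canonical map `I ⊗_R F → F` is injective.
Since `I ⊗_R F` is the quotient of `I ⊗[ℤ] F` by the balanced relations (all of which are
killed by `idealSmul`), this injectivity says exactly that the kernel of `idealSmul`
is contained in the subgroup of balanced relations. -/
def ModFlat (R : Type u) [Ring R] (F : Type u) [AddCommGroup F] [Module R F] : Prop :=
  ∀ I : Submodule Rᵐᵒᵖ R, I.FG →
    LinearMap.ker (idealSmul R F I) ≤ balRel R (↥I) F

/-- `fddGE R n M` holds iff there is an exact sequence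
`0 → M → I^0 → ⋯ → I^(n-1)` of left `R`-modules in which every `I^j` is both
flat and injective; i.e. the (left) flat-dominant dimension of `M` is at least `n`. -/
def fddGE (R : Type u) [Ring R] :
    ℕ → (M : Type u) → [AddCommGroup M] → [Module R M] → Prop
  | 0, _, _, _ => True
  | (n+1), M, iM, mM =>
      letI := iM; letI := mM
      ∃ (I : Type u) (_ : AddCommGroup I) (_ : Module R I),
        ModFlat R I ∧ Module.Injective R I ∧
        ∃ f : M →ₗ[R] I, Function.Injective f ∧ fddGE R n (I ⧸ LinearMap.range f)
section FrobeniusBimodule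

variable (S R M : Type u) [Ring S] [Ring R] [AddCommGroup M]
  [Module S M] [Module Rᵐᵒᵖ M] [SMulCommClass S Rᵐᵒᵖ M] [SMulCommClass Rᵐᵒᵖ S M]

/-- The right action of `r : R` on the `S`-`R`-bimodule `M`, as an `S`-linear map. -/
def ract (r : R) : M →ₗ[S] M where
  toFun m := op r • m
  map_add' _ _ := smul_add _ _ _
  map_smul' s m := smul_comm (op r) s m

/-- The left action of `s : S` on the `S`-`R`-bimodule `M`, as a right `R`-linear map. -/
def lact (s : S) : M →ₗ[Rᵐᵒᵖ] M where
  toFun m := s • m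
  map_add' _ _ := smul_add _ _ _
  map_smul' r m := smul_comm s r m

/-- Left multiplication by `r : R` on `R`, as a right `R`-linear map. -/
def mulLeft' (r : R) : R →ₗ[Rᵐᵒᵖ] R where
  toFun x := r * x
  map_add' := mul_add r
  map_smul' a x := by
    simp only [MulOpposite.smul_eq_mul_unop, RingHom.id_apply, mul_assoc]

/-- An `S`-`R`-bimodule `M` is a Frobenius bimodule if it is finitely generated projective
as a left `S`-module and as a right `R`-module, and `Hom_S(M, S) ≅ Hom_{Rᵒᵖ}(M, R)` as
`R`-`S`-bimodules.  Here `Hom_S(M, S)` is an `R`-`S`-bimodule via `(r • f • s) m = f (m r) s`,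
and `Hom_{Rᵒᵖ}(M, R)` is an `R`-`S`-bimodule via `(r • g • s) m = r * g (s • m)`; the
bimodule conditions on the additive isomorphism `e` are stated via the two compatibilities
below. -/
def IsFrobeniusBimodule : Prop :=
  Module.Finite S M ∧ Module.Projective S M ∧
  Module.Finite Rᵐᵒᵖ M ∧ Module.Projective Rᵐᵒᵖ M ∧
  ∃ e : (M →ₗ[S] S) ≃+ (M →ₗ[Rᵐᵒᵖ] R),
    (∀ (r : R) (f : M →ₗ[S] S), e (f ∘ₗ ract S R M r) = mulLeft' R r ∘ₗ e f) ∧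
    (∀ (s : S) (f : M →ₗ[S] S),
      e (LinearMap.toSpanSingleton S S s ∘ₗ f) = e f ∘ₗ lact S R M s)

variable (Y : Type u) [AddCommGroup Y] [Module S Y]

/-- `Hom_S(M, Y)` is a left `R`-module via the right action of `R` on `M`:
`(r • f) m = f (m r)`. -/
instance homLeftModule : Module R (M →ₗ[S] Y) where
  smul r f := f ∘ₗ ract S R M r
  one_smul f := by ext m; show f _ = f m; simp [ract]
  mul_smul r r' f := by ext m; show f _ = f _; simp [ract, op_mul, mul_smul]
  smul_zero r := rfl
  smul_add r f g := rfl
  add_smul r r' f := by ext m; show f _ = f _ + f _; simp [ract, op_add, add_smul, map_add]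
  zero_smul f := by ext m; show f _ = 0; simp [ract]

end FrobeniusBimodule
section NCTensor

variable (R : Type u) [Ring R] (M : Type u) [AddCommGroup M] [Module Rᵐᵒᵖ M]
  (X : Type u) [AddCommGroup X] [Module R X]
  (S : Type u) [Ring S] [Module S M] [SMulCommClass Rᵐᵒᵖ S M]

/-- The submodule of balanced relations in `M ⊗[ℤ] X`, where `M` is an `S`-`R`-bimodule
and `X` a left `R`-module.  Since the generating set is stable under the action of `S`,
its `S`-span coincides with its additive span. -/
def balS : Submodule S (TensorProduct ℤ M X) :=
  Submodule.span S
    {z | ∃ (m : M) (r : R) (x : X), z = m ⊗ₜ[ℤ] (r • x) - ((op r) • m) ⊗ₜ[ℤ] x}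

/-- The tensor product `M ⊗_R X` over the (possibly noncommutative) ring `R`, for a right
`R`-module `M` and a left `R`-module `X`: the quotient of `M ⊗[ℤ] X` by the balanced
relations.  When `M` is an `S`-`R`-bimodule this is a left `S`-module. -/
def NCT := (TensorProduct ℤ M X) ⧸ balS R M X S

noncomputable instance : AddCommGroup (NCT R M X S) :=
  inferInstanceAs (AddCommGroup ((TensorProduct ℤ M X) ⧸ balS R M X S))

noncomputable instance : Module S (NCT R M X S) :=
  inferInstanceAs (Module S ((TensorProduct ℤ M X) ⧸ balS R M X S))

/-- The class of the pure tensor `m ⊗ x` in `M ⊗_R X`. -/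
noncomputable def mkT (m : M) (x : X) : NCT R M X S :=
  Submodule.Quotient.mk (m ⊗ₜ[ℤ] x)

end NCTensor

section DualBasis

/-- A finite dual basis of a finitely generated projective left module. -/
lemma exists_left_dualBasis (S M : Type u) [Ring S] [AddCommGroup M] [Module S M]
    [Module.Finite S M] [Module.Projective S M] :
    ∃ (n : ℕ) (p : Fin n → M) (f : Fin n → M →ₗ[S] S), ∀ m, ∑ i, f i m • p i = m := by
  obtain ⟨n, π, σ, -, -, h⟩ := Module.Finite.exists_comp_eq_id_of_projective S M
  refine ⟨n, fun i => π (Pi.single i 1), fun i => LinearMap.proj i ∘ₗ σ, fun m => ?_⟩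
  have h1 : π (σ m) = m := LinearMap.congr_fun h m
  conv_rhs => rw [← h1, pi_eq_sum_univ' (σ m), map_sum]
  refine Finset.sum_congr rfl fun i _ => ?_
  simp only [LinearMap.comp_apply, LinearMap.proj_apply]
  rw [← map_smul]

/-- A finite dual basis of a finitely generated projective right module. -/
lemma exists_right_dualBasis (R M : Type u) [Ring R] [AddCommGroup M] [Module Rᵐᵒᵖ M]
    [Module.Finite Rᵐᵒᵖ M] [Module.Projective Rᵐᵒᵖ M] :
    ∃ (n : ℕ) (p : Fin n → M) (g : Fin n → M →ₗ[Rᵐᵒᵖ] R), ∀ m, ∑ i, op (g i m) • p i = m := by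
  obtain ⟨n, p, f, h⟩ := exists_left_dualBasis Rᵐᵒᵖ M
  refine ⟨n, p, fun i =>
    { toFun := fun m => unop (f i m)
      map_add' := fun a b => by simp
      map_smul' := fun r m => by simp [MulOpposite.smul_eq_mul_unop] }, fun m => ?_⟩
  simpa using h m

end DualBasis

section NCTensorLemmas

variable {R : Type u} [Ring R] {M : Type u} [AddCommGroup M] [Module Rᵐᵒᵖ M]
  {X : Type u} [AddCommGroup X] [Module R X]
  {S : Type u} [Ring S] [Module S M]

variable (S) in
/-- `mkT` as a biadditive map. -/
noncomputable def mkTHom (m : M) : X →+ NCT R M X S :=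
  AddMonoidHom.mk' (mkT R M X S m) fun x y =>
    congrArg (Submodule.Quotient.mk (p := balS R M X S)) (TensorProduct.tmul_add m x y)

lemma mkT_add (m : M) (x y : X) : mkT R M X S m (x + y) = mkT R M X S m x + mkT R M X S m y :=
  (mkTHom S m).map_add x y

lemma mkT_zero (m : M) : mkT R M X S m (0 : X) = 0 := (mkTHom S m).map_zero

lemma mkT_sum {ι : Type*} (s : Finset ι) (m : M) (x : ι → X) :
    mkT R M X S m (∑ i ∈ s, x i) = ∑ i ∈ s, mkT R M X S m (x i) :=
  map_sum (mkTHom S m) x s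

lemma add_mkT (m m' : M) (x : X) :
    mkT R M X S (m + m') x = mkT R M X S m x + mkT R M X S m' x :=
  congrArg (Submodule.Quotient.mk (p := balS R M X S)) (TensorProduct.add_tmul m m' x)

lemma smul_mkT (s : S) (m : M) (x : X) : s • mkT R M X S m x = mkT R M X S (s • m) x :=
  congrArg (Submodule.Quotient.mk (p := balS R M X S)) (TensorProduct.smul_tmul' s m x)

lemma sum_mkT {ι : Type*} (s : Finset ι) (m : ι → M) (x : X) :
    mkT R M X S (∑ i ∈ s, m i) x = ∑ i ∈ s, mkT R M X S (m i) x :=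
  map_sum (AddMonoidHom.mk' (fun m => mkT R M X S m x) fun a b => add_mkT a b x) m s

lemma mkT_smul (m : M) (r : R) (x : X) : mkT R M X S m (r • x) = mkT R M X S (op r • m) x :=
  (Submodule.Quotient.eq _).2 (Submodule.subset_span ⟨m, r, x, rfl⟩)

lemma NCT.induction {P : NCT R M X S → Prop} (h0 : P 0) (hT : ∀ m x, P (mkT R M X S m x))
    (ha : ∀ a b, P a → P b → P (a + b)) (t : NCT R M X S) : P t := by
  obtain ⟨z, rfl⟩ := Submodule.Quotient.mk_surjective _ t
  induction z using TensorProduct.induction_on with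
  | zero => exact h0
  | tmul m x => exact hT m x
  | add a b iha ihb => exact ha _ _ iha ihb

/-- A balanced biadditive map out of `M × X` factors through `M ⊗_R X`. -/
lemma NCT.exists_lift [SMulCommClass Rᵐᵒᵖ S M] {Z : Type u} [AddCommGroup Z] (β : M →+ X →+ Z)
    (hβ : ∀ m (r : R) x, β m (r • x) = β (op r • m) x) :
    ∃ L : NCT R M X S →+ Z, ∀ m x, L (mkT R M X S m x) = β m x := by
  let B : TensorProduct ℤ M X →+ Z :=
    TensorProduct.liftAddHom β fun n m x => by simp
  have hB : ∀ z ∈ (balS R M X S).toAddSubgroup, B z = 0 := by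
    intro z hz
    suffices h : ∀ s : S, B (s • z) = 0 by simpa using h 1
    refine Submodule.span_induction (p := fun z _ => ∀ s : S, B (s • z) = 0) ?_ ?_ ?_ ?_ hz
    · rintro _ ⟨m, r, x, rfl⟩ s
      rw [smul_sub, TensorProduct.smul_tmul', TensorProduct.smul_tmul', map_sub, sub_eq_zero,
        ← smul_comm (op r) s m]
      exact hβ (s • m) r x
    · simp
    · intro a b _ _ iha ihb s
      rw [smul_add, map_add, iha, ihb, add_zero]
    · intro t a _ ih s
      rw [← mul_smul]
      exact ih _
  exact ⟨QuotientAddGroup.lift (balS R M X S).toAddSubgroup B hB, fun m x => rfl⟩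

variable [SMulCommClass Rᵐᵒᵖ S M]

variable (S X) in
/-- Applying a right linear functional in the first factor: `m ⊗ x ↦ g m • x`. -/
noncomputable def evT (g : M →ₗ[Rᵐᵒᵖ] R) : NCT R M X S →+ X :=
  (NCT.exists_lift (S := S)
    (((AddMonoidHom.smul : R →+ X →+ X)).comp g.toAddMonoidHom)
    fun m r x => by simp [MulOpposite.smul_eq_mul_unop, mul_smul]).choose

@[simp] lemma evT_mkT (g : M →ₗ[Rᵐᵒᵖ] R) (m : M) (x : X) :
    evT X S g (mkT R M X S m x) = g m • x :=
  (NCT.exists_lift (S := S)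
    (((AddMonoidHom.smul : R →+ X →+ X)).comp g.toAddMonoidHom)
    fun m r x => by simp [MulOpposite.smul_eq_mul_unop, mul_smul]).choose_spec m x

lemma evT_sum {ι : Type*} (s : Finset ι) (g : ι → M →ₗ[Rᵐᵒᵖ] R) (t : NCT R M X S) :
    evT X S (∑ i ∈ s, g i) t = ∑ i ∈ s, evT X S (g i) t := by
  induction t using NCT.induction with
  | h0 => simp
  | hT m x => simp [Finset.sum_smul, LinearMap.sum_apply]
  | ha a b iha ihb => simp [iha, ihb, Finset.sum_add_distrib]

lemma evT_mulLeft (r : R) (g : M →ₗ[Rᵐᵒᵖ] R) (t : NCT R M X S) :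
    evT X S (mulLeft' R r ∘ₗ g) t = r • evT X S g t := by
  induction t using NCT.induction with
  | h0 => simp
  | hT m x => simp [mulLeft', mul_smul]
  | ha a b iha ihb => simp [iha, ihb]

lemma evT_smul [SMulCommClass S Rᵐᵒᵖ M] (s : S) (g : M →ₗ[Rᵐᵒᵖ] R) (t : NCT R M X S) :
    evT X S g (s • t) = evT X S (g ∘ₗ lact S R M s) t := by
  induction t using NCT.induction with
  | h0 => simp
  | hT m x => simp [smul_mkT, lact]
  | ha a b iha ihb => simp [iha, ihb, smul_add]

lemma sum_mkT_evT {n : ℕ} {p : Fin n → M} {g : Fin n → M →ₗ[Rᵐᵒᵖ] R}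
    (h : ∀ m, ∑ i, op (g i m) • p i = m) (t : NCT R M X S) :
    ∑ i, mkT R M X S (p i) (evT X S (g i) t) = t := by
  induction t using NCT.induction with
  | h0 => simp [mkT_zero]
  | hT m x => simp [mkT_smul, ← sum_mkT, h]
  | ha a b iha ihb => simp [mkT_add, Finset.sum_add_distrib, iha, ihb]

end NCTensorLemmas

section Projective

variable {S R M : Type u} [Ring S] [Ring R] [AddCommGroup M]
  [Module S M] [Module Rᵐᵒᵖ M] [SMulCommClass Rᵐᵒᵖ S M]
  {X : Type u} [AddCommGroup X] [Module R X]

/-- Postcomposition `Hom_S(M, A) → Hom_S(M, B)` as an `R`-linear map. -/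
def homPostcomp (R M : Type u) [Ring R] [AddCommGroup M] [Module S M] [Module Rᵐᵒᵖ M]
    [SMulCommClass Rᵐᵒᵖ S M] {A B : Type u} [AddCommGroup A] [Module S A]
    [AddCommGroup B] [Module S B] (φ : A →ₗ[S] B) :
    letI := homLeftModule S R M A
    letI := homLeftModule S R M B
    (M →ₗ[S] A) →ₗ[R] (M →ₗ[S] B) :=
  letI := homLeftModule S R M A
  letI := homLeftModule S R M B
  { toFun := fun f => φ ∘ₗ f
    map_add' := fun f g => LinearMap.comp_add f g φ
    map_smul' := fun _ _ => rfl }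

theorem NCT.projective [Module.Projective S M] [Module.Projective R X] :
    Module.Projective S (NCT R M X S) := by
  refine Module.Projective.of_lifting_property'' fun π hπ => ?_
  let η : X →ₗ[R] (M →ₗ[S] NCT R M X S) :=
    { toFun := fun x =>
        { toFun := fun m => mkT R M X S m x
          map_add' := fun a b => add_mkT a b x
          map_smul' := fun s m => (smul_mkT s m x).symm }
      map_add' := fun x y => by ext m; exact mkT_add m x y
      map_smul' := fun r x => by ext m; exact mkT_smul m r x }
  have hsurj : Function.Surjective (homPostcomp R M π) := fun f =>
    Module.projective_lifting_property π f hπ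
  obtain ⟨θ, hθ⟩ := Module.projective_lifting_property (homPostcomp R M π) η hsurj
  obtain ⟨L, hL⟩ := NCT.exists_lift (R := R) (M := M) (X := X) (S := S) (Z := NCT R M X S →₀ S)
    (AddMonoidHom.mk' (fun m => AddMonoidHom.mk' (fun x => θ x m) fun x y => by simp)
      fun m m' => by ext x : 1; simp)
    fun m r x => by
      show θ (r • x) m = θ x (op r • m)
      rw [map_smul]
      rfl
  have hLs : ∀ (s : S) t, L (s • t) = s • L t := fun s t => by
    induction t using NCT.induction with
    | h0 => simp
    | hT m x => rw [smul_mkT, hL, hL]; exact (θ x).map_smul s m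
    | ha a b iha ihb => simp [iha, ihb, smul_add]
  refine ⟨{ toFun := L, map_add' := L.map_add, map_smul' := hLs }, LinearMap.ext fun t => ?_⟩
  show π (L t) = t
  induction t using NCT.induction with
  | h0 => simp
  | hT m x =>
    rw [hL]
    exact LinearMap.congr_fun (LinearMap.congr_fun hθ x) m
  | ha a b iha ihb => simp [iha, ihb]

end Projective

section Injective

variable {S R M : Type u} [Ring S] [Ring R] [AddCommGroup M]
  [Module S M] [Module Rᵐᵒᵖ M] [SMulCommClass S Rᵐᵒᵖ M] [SMulCommClass Rᵐᵒᵖ S M]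
  {X : Type u} [AddCommGroup X] [Module R X]

omit [Module Rᵐᵒᵖ M] [SMulCommClass S Rᵐᵒᵖ M] [SMulCommClass Rᵐᵒᵖ S M] in
lemma sum_toSpanSingleton_comp {n : ℕ} {p : Fin n → M} {f : Fin n → M →ₗ[S] S}
    (hp : ∀ m, ∑ i, f i m • p i = m) {A : Type u} [AddCommGroup A] [Module S A]
    (h : M →ₗ[S] A) : ∑ i, LinearMap.toSpanSingleton S A (h (p i)) ∘ₗ f i = h := by
  ext m
  conv_rhs => rw [← hp m]
  simp [LinearMap.sum_apply]

omit [SMulCommClass S Rᵐᵒᵖ M] [Module S M] [SMulCommClass Rᵐᵒᵖ S M] in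
lemma sum_mulLeft_comp {n : ℕ} {q : Fin n → M} {g : Fin n → M →ₗ[Rᵐᵒᵖ] R}
    (hq : ∀ m, ∑ i, op (g i m) • q i = m) (h : M →ₗ[Rᵐᵒᵖ] R) :
    ∑ i, mulLeft' R (h (q i)) ∘ₗ g i = h := by
  ext m
  conv_rhs => rw [← hq m]
  simp [LinearMap.sum_apply, mulLeft', MulOpposite.smul_eq_mul_unop]

/-- The counit of the adjunction between `Hom_S(M, -)` and `M ⊗_R -` afforded by an isomorphism
`Hom_S(M, S) ≅ Hom_{Rᵒᵖ}(M, R)`. -/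
lemma exists_counit (e : (M →ₗ[S] S) ≃+ (M →ₗ[Rᵐᵒᵖ] R))
    (heR : ∀ (r : R) (f : M →ₗ[S] S), e (f ∘ₗ ract S R M r) = mulLeft' R r ∘ₗ e f)
    (heS : ∀ (s : S) (f : M →ₗ[S] S),
      e (LinearMap.toSpanSingleton S S s ∘ₗ f) = e f ∘ₗ lact S R M s)
    [Module.Finite S M] [Module.Projective S M] :
    ∃ ε : (M →ₗ[S] NCT R M X S) →ₗ[R] X, ∀ (u : M →ₗ[S] S) (t : NCT R M X S),
      ε (LinearMap.toSpanSingleton S _ t ∘ₗ u) = evT X S (e u) t := by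
  obtain ⟨n, p, f, hp⟩ := exists_left_dualBasis S M
  have key : ∀ (u : M →ₗ[S] S) (t : NCT R M X S),
      ∑ l, evT X S (e (f l)) (u (p l) • t) = evT X S (e u) t := fun u t => by
    simp_rw [evT_smul, ← heS]
    rw [← evT_sum, ← map_sum, sum_toSpanSingleton_comp hp]
  refine ⟨{ toFun := fun h => ∑ l, evT X S (e (f l)) (h (p l))
            map_add' := fun a b => by simp [Finset.sum_add_distrib]
            map_smul' := fun r h => ?_ }, key⟩
  show ∑ l, evT X S (e (f l)) (h (op r • p l)) = r • ∑ l, evT X S (e (f l)) (h (p l))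
  have hexp : ∀ l, h (op r • p l) = ∑ j, (f j ∘ₗ ract S R M r) (p l) • h (p j) := fun l => by
    conv_lhs => rw [← hp (op r • p l), map_sum]
    simp [ract]
  simp_rw [hexp, map_sum]
  rw [Finset.sum_comm, Finset.smul_sum]
  refine Finset.sum_congr rfl fun j _ => ?_
  rw [key, heR, evT_mulLeft]

theorem NCT.injective (hM : IsFrobeniusBimodule S R M) [Module.Injective R X] :
    Module.Injective S (NCT R M X S) := by
  obtain ⟨_, _, _, _, e, heR, heS⟩ := hM
  obtain ⟨n, q, g, hq⟩ := exists_right_dualBasis R M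
  obtain ⟨ε, hε⟩ := exists_counit (X := X) e heR heS
  refine ⟨fun A B _ _ _ _ i hi φ => ?_⟩
  have hinj : Function.Injective (homPostcomp R M i) := fun a b hab =>
    LinearMap.ext fun m => hi (LinearMap.congr_fun hab m)
  obtain ⟨ψ, hψ⟩ := Module.Injective.out (homPostcomp R M i) hinj (ε ∘ₗ homPostcomp R M φ)
  let w : Fin n → B →+ X := fun k => AddMonoidHom.mk'
    (fun b => ψ (LinearMap.toSpanSingleton S B b ∘ₗ e.symm (g k))) fun a b => by
      rw [← map_add]
      congr 1
      ext m
      simp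
  have hw : ∀ k s b, w k (s • b) = ∑ j, g k (s • q j) • w j b := fun k s b => by
    show ψ _ = ∑ j, _ • ψ _
    simp_rw [← map_smul, ← map_sum]
    congr 1
    have h1 : LinearMap.toSpanSingleton S S s ∘ₗ e.symm (g k) =
        ∑ j, e.symm (g j) ∘ₗ ract S R M (g k (s • q j)) := by
      apply e.injective
      rw [heS, map_sum]
      simp_rw [heR, AddEquiv.apply_symm_apply]
      exact (sum_mulLeft_comp hq (g k ∘ₗ lact S R M s)).symm
    ext m
    have h2 := LinearMap.congr_fun h1 m
    simp only [LinearMap.comp_apply, LinearMap.toSpanSingleton_apply, LinearMap.sum_apply,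
      smul_eq_mul] at h2 ⊢
    rw [← mul_smul, h2, Finset.sum_smul]
    rfl
  refine ⟨{ toFun := fun b => ∑ k, mkT R M X S (q k) (w k b)
            map_add' := fun a b => by simp [mkT_add, Finset.sum_add_distrib]
            map_smul' := fun s b => ?_ }, fun a => ?_⟩
  · simp_rw [hw, mkT_sum, mkT_smul]
    rw [Finset.sum_comm, RingHom.id_apply, Finset.smul_sum]
    refine Finset.sum_congr rfl fun j _ => ?_
    rw [← sum_mkT, hq, smul_mkT]
  · show ∑ k, mkT R M X S (q k) (w k (i a)) = φ a
    refine Eq.trans (Finset.sum_congr rfl fun k _ => ?_) (sum_mkT_evT hq (φ a))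
    congr 1
    have h1 := hψ (LinearMap.toSpanSingleton S A a ∘ₗ e.symm (g k))
    have h2 := hε (e.symm (g k)) (φ a)
    rw [e.apply_symm_apply] at h2
    rw [← h2]
    refine Eq.trans (congrArg ψ ?_) (h1.trans (congrArg ε ?_)) <;> ext m <;>
      simp [homPostcomp]

end Injective

section Flat

/-- The equational criterion: every linear relation in `F` is a consequence of linear relations
in the ring. -/
def EquationallyFlat (R : Type u) [Ring R] (F : Type u) [AddCommGroup F] [Module R F] : Prop :=
  ∀ (ι : Type) [Fintype ι] (r : ι → R) (x : ι → F), ∑ i, r i • x i = 0 →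
    ∃ (J : Type) (_ : Fintype J) (y : J → F) (a : ι → J → R),
      (∀ i, x i = ∑ j, a i j • y j) ∧ ∀ j, ∑ i, r i * a i j = 0

variable {R : Type u} [Ring R] {X : Type u} [AddCommGroup X] [Module R X]

@[simp] lemma idealSmul_tmul (I : Submodule Rᵐᵒᵖ R) (i : I) (x : X) :
    idealSmul R X I (i ⊗ₜ[ℤ] x) = (i : R) • x := rfl

/-- The subgroup of `X ^ ι` generated by the vectors `(k i • y)` with `∑ r i * k i = 0`. -/
def relVectors {ι : Type} [Fintype ι] (r : ι → R) (X : Type u) [AddCommGroup X] [Module R X] :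
    AddSubgroup (ι → X) :=
  AddSubgroup.closure {z | ∃ (k : ι → R) (y : X), ∑ i, r i * k i = 0 ∧ z = fun i => k i • y}

lemma exists_of_mem_relVectors {ι : Type} [Fintype ι] {r : ι → R} {x : ι → X}
    (hx : x ∈ relVectors r X) :
    ∃ (J : Type) (_ : Fintype J) (y : J → X) (a : ι → J → R),
      (∀ i, x i = ∑ j, a i j • y j) ∧ ∀ j, ∑ i, r i * a i j = 0 := by
  induction hx using AddSubgroup.closure_induction with
  | mem z hz =>
    obtain ⟨k, y, hk, rfl⟩ := hz
    exact ⟨Unit, inferInstance, fun _ => y, fun i _ => k i, by simp, fun _ => hk⟩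
  | zero => exact ⟨Empty, inferInstance, Empty.elim, fun _ => Empty.elim, by simp, nofun⟩
  | add z w _ _ hz hw =>
    obtain ⟨J, _, y, a, h1, h2⟩ := hz
    obtain ⟨J', _, y', a', h1', h2'⟩ := hw
    refine ⟨J ⊕ J', inferInstance, Sum.elim y y', fun i => Sum.elim (a i) (a' i), fun i => ?_, ?_⟩
    · simp [Fintype.sum_sum_type, h1, h1']
    · rintro (j | j)
      exacts [h2 j, h2' j]
  | neg z _ hz =>
    obtain ⟨J, _, y, a, h1, h2⟩ := hz
    exact ⟨J, inferInstance, fun j => -y j, a, fun i => by simp [h1], h2⟩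

theorem ModFlat.equationallyFlat (h : ModFlat R X) : EquationallyFlat R X := by
  intro ι _ r x hrx
  classical
  apply exists_of_mem_relVectors
  have hW : ∀ k : ι → R, ∑ i, r i * k i = 0 → ∀ y : X, (fun i => k i • y) ∈ relVectors r X :=
    fun k hk y => AddSubgroup.subset_closure ⟨k, y, hk, rfl⟩
  let I : Submodule Rᵐᵒᵖ R := Submodule.span Rᵐᵒᵖ (Set.range r)
  have hI : ∀ i : I, ∃ c : ι → R, ∑ l, r l * c l = i := fun i => by
    obtain ⟨c, hc⟩ := (Submodule.mem_span_range_iff_exists_fun Rᵐᵒᵖ).1 i.2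
    exact ⟨fun l => unop (c l), by simpa [MulOpposite.smul_eq_mul_unop] using hc⟩
  choose c hc using hI
  let β : I →+ X →+ (ι → X) ⧸ relVectors r X := AddMonoidHom.mk'
    (fun i => AddMonoidHom.mk' (fun x => QuotientAddGroup.mk fun l => c i l • x) fun x y => by
      rw [← QuotientAddGroup.mk_add]
      congr 1
      ext l
      simp) fun i i' => by
      ext x
      simp only [AddMonoidHom.mk'_apply, AddMonoidHom.add_apply]
      rw [← QuotientAddGroup.mk_add, QuotientAddGroup.eq]
      convert hW (fun l => -c (i + i') l + (c i l + c i' l))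
        (by simp [mul_add, Finset.sum_add_distrib, hc]) x using 1
      ext l
      simp [add_smul]
  let B : TensorProduct ℤ I X →+ (ι → X) ⧸ relVectors r X :=
    TensorProduct.liftAddHom β fun n m x => by simp
  have hB : ∀ z ∈ balRel R I X, B z = 0 := by
    intro z hz
    induction hz using Submodule.span_induction with
    | mem z hz =>
      obtain ⟨i, s, x, rfl⟩ := hz
      rw [map_sub, sub_eq_zero]
      show (QuotientAddGroup.mk (fun l => c i l • s • x) : (ι → X) ⧸ relVectors r X) =
        QuotientAddGroup.mk (fun l => c (op s • i) l • x)
      rw [QuotientAddGroup.eq]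
      convert hW (fun l => -(c i l * s) + c (op s • i) l)
        (by simp [mul_add, Finset.sum_add_distrib, hc, ← mul_assoc, ← Finset.sum_mul,
              MulOpposite.smul_eq_mul_unop]) x using 1
      ext l
      simp [add_smul, mul_smul]
    | zero => simp
    | add a b _ _ iha ihb => simp [iha, ihb]
    | smul n a _ ih => simp [ih]
  let i₀ : ι → I := fun l => ⟨r l, Submodule.subset_span ⟨l, rfl⟩⟩
  have h0 := hB (∑ l, i₀ l ⊗ₜ[ℤ] x l)
    (h I (Submodule.fg_span (Set.finite_range r)) (by simpa [i₀] using hrx))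
  have h1 : (∑ j, fun l => c (i₀ j) l • x j) ∈ relVectors r X := by
    rw [← QuotientAddGroup.eq_zero_iff, ← h0, map_sum]
    exact map_sum (QuotientAddGroup.mk' (relVectors r X)) _ _
  have h2 : (∑ j, fun l => ((Pi.single j 1 : ι → R) l - c (i₀ j) l) • x j) ∈ relVectors r X :=
    sum_mem fun j _ => hW _ (by simp [mul_sub, hc, i₀, Pi.single_apply]) _
  convert add_mem h1 h2
  ext l
  simp [Finset.sum_apply, sub_smul, Pi.single_apply]

theorem EquationallyFlat.modFlat (h : EquationallyFlat R X) : ModFlat R X := by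
  intro I _ z hz
  obtain ⟨n, i, x, rfl⟩ : ∃ (n : ℕ) (i : Fin n → I) (x : Fin n → X), z = ∑ k, i k ⊗ₜ[ℤ] x k := by
    obtain ⟨T, rfl⟩ := TensorProduct.exists_finset z
    refine ⟨_, fun k => (T.equivFin.symm k).1.1, fun k => (T.equivFin.symm k).1.2, ?_⟩
    rw [T.equivFin.symm.sum_comp fun k => k.1.1 ⊗ₜ[ℤ] k.1.2]
    exact (Finset.sum_coe_sort T fun k => k.1 ⊗ₜ[ℤ] k.2).symm
  obtain ⟨J, _, y, a, hx, ha⟩ := h (Fin n) (fun k => (i k : R)) x (by simpa using hz)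
  have h0 : ∑ k, ∑ j, (op (a k j) • i k) ⊗ₜ[ℤ] y j = 0 := by
    rw [Finset.sum_comm]
    refine Finset.sum_eq_zero fun j _ => ?_
    rw [← TensorProduct.sum_tmul]
    have : ∑ k, op (a k j) • i k = 0 := by
      ext
      simpa [MulOpposite.smul_eq_mul_unop] using ha j
    rw [this, TensorProduct.zero_tmul]
  rw [← sub_zero (∑ k, _), ← h0, ← Finset.sum_sub_distrib]
  refine sum_mem fun k _ => ?_
  rw [hx, TensorProduct.tmul_sum, ← Finset.sum_sub_distrib]
  exact sum_mem fun j _ => Submodule.subset_span ⟨i k, a k j, y j, rfl⟩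

/-- The equational criterion for finite systems of linear relations. -/
lemma EquationallyFlat.exists_factor (h : EquationallyFlat R X) {ι : Type} [Fintype ι]
    {κ : Type} (s : Finset κ) (A : κ → ι → R) (x : ι → X) (hA : ∀ l ∈ s, ∑ i, A l i • x i = 0) :
    ∃ (J : Type) (_ : Fintype J) (y : J → X) (a : ι → J → R),
      (∀ i, x i = ∑ j, a i j • y j) ∧ ∀ l ∈ s, ∀ j, ∑ i, A l i * a i j = 0 := by
  classical
  induction s using Finset.induction_on with
  | empty => exact ⟨ι, inferInstance, x, fun i => Pi.single i 1, by simp [Pi.single_apply], by simp⟩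
  | insert l s _ ih =>
    obtain ⟨J, _, y, a, hx, ha⟩ := ih fun l' hl' => hA l' (Finset.mem_insert_of_mem hl')
    have h1 : ∑ j, (∑ i, A l i * a i j) • y j = 0 := by
      rw [← hA l (Finset.mem_insert_self l s)]
      simp_rw [hx, Finset.smul_sum, Finset.sum_smul, mul_smul]
      exact Finset.sum_comm
    obtain ⟨K, _, z, b, hy, hb⟩ := h J _ y h1
    have h2 : ∀ l' k, ∑ i, A l' i * ∑ j, a i j * b j k = ∑ j, (∑ i, A l' i * a i j) * b j k :=
      fun l' k => by
        simp_rw [Finset.mul_sum, Finset.sum_mul, mul_assoc]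
        exact Finset.sum_comm
    refine ⟨K, inferInstance, z, fun i k => ∑ j, a i j * b j k, fun i => ?_, ?_⟩
    · rw [hx]
      simp_rw [hy, Finset.smul_sum, Finset.sum_smul, mul_smul]
      exact Finset.sum_comm
    · intro l' hl' k
      rw [h2]
      rcases Finset.mem_insert.1 hl' with rfl | hl'
      · exact hb k
      · simp [ha l' hl']

theorem NCT.equationallyFlat {S M : Type u} [Ring S] [AddCommGroup M] [Module S M]
    [Module Rᵐᵒᵖ M] [SMulCommClass Rᵐᵒᵖ S M]
    [Module.Finite S M] [Module.Projective S M] [Module.Finite Rᵐᵒᵖ M] [Module.Projective Rᵐᵒᵖ M]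
    (h : EquationallyFlat R X) : EquationallyFlat S (NCT R M X S) := by
  intro ι _ s t hst
  obtain ⟨n, p, f, hp⟩ := exists_left_dualBasis S M
  obtain ⟨m, q, g, hq⟩ := exists_right_dualBasis R M
  obtain ⟨J, _, y, a, hx, ha⟩ := h.exists_factor (ι := ι × Fin m) (κ := Fin m) Finset.univ
    (fun l ik => g l (s ik.1 • q ik.2)) (fun ik => evT X S (g ik.2) (t ik.1)) fun l _ => by
      rw [Fintype.sum_prod_type]
      have h1 : evT X S (g l) (∑ i, s i • t i) = 0 := by rw [hst, map_zero]
      rw [← h1, map_sum]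
      refine Finset.sum_congr rfl fun i _ => ?_
      conv_rhs => rw [← sum_mkT_evT hq (t i), Finset.smul_sum, map_sum]
      simp [smul_mkT]
  let v : ι → J → M := fun i j => ∑ k, op (a (i, k) j) • q k
  have ht : ∀ i, t i = ∑ j, mkT R M X S (v i j) (y j) := fun i => by
    rw [← sum_mkT_evT hq (t i)]
    simp_rw [fun k => hx (i, k), mkT_sum, mkT_smul, v, sum_mkT]
    exact Finset.sum_comm
  have hv : ∀ j, ∑ i, s i • v i j = 0 := fun j => by
    rw [← hq (∑ i, s i • v i j)]
    refine Finset.sum_eq_zero fun l _ => ?_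
    have h1 := ha l (Finset.mem_univ l) j
    rw [Fintype.sum_prod_type] at h1
    have h2 : g l (∑ i, s i • v i j) = 0 := by
      rw [← h1]
      simp [v, Finset.smul_sum, ← smul_comm (op _) (s _), MulOpposite.smul_eq_mul_unop]
    rw [h2, op_zero, zero_smul]
  refine ⟨J × Fin n, inferInstance, fun jl => mkT R M X S (p jl.2) (y jl.1),
    fun i jl => f jl.2 (v i jl.1), fun i => ?_, fun jl => ?_⟩
  · rw [ht, Fintype.sum_prod_type]
    refine Finset.sum_congr rfl fun j _ => ?_
    simp_rw [smul_mkT]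
    rw [← sum_mkT, hp]
  · have h1 := congrArg (f jl.2) (hv jl.1)
    simpa using h1

end Flat

theorem stmt3 (S R M : Type u) [Ring S] [Ring R] [AddCommGroup M]
    [Module S M] [Module Rᵐᵒᵖ M] [SMulCommClass S Rᵐᵒᵖ M] [SMulCommClass Rᵐᵒᵖ S M]
    (hM : IsFrobeniusBimodule S R M)
    (X : Type u) [AddCommGroup X] [Module R X] :
    (Module.Injective R X → Module.Injective S (NCT R M X S)) ∧
    (Module.Projective R X → Module.Projective S (NCT R M X S)) ∧
    (ModFlat R X → ModFlat S (NCT R M X S)) ∧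
    (ModFlat R X → Module.Injective R X →
      ModFlat S (NCT R M X S) ∧ Module.Injective S (NCT R M X S)) := by
  have hI : Module.Injective R X → Module.Injective S (NCT R M X S) := fun _ => NCT.injective hM
  obtain ⟨_, _, _, _, -⟩ := hM
  have hF : ModFlat R X → ModFlat S (NCT R M X S) := fun h =>
    (NCT.equationallyFlat h.equationallyFlat).modFlat
  exact ⟨hI, fun _ => NCT.projective, hF, fun h h' => ⟨hF h, hI h'⟩⟩
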